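/- Let Ω ⊆ ℝ³ be a connected, simply connected open set, let ε be a twice continuously differentiable symmetric 3×3 matrix field on Ω satisfying the St.-Venant compatibility condition, and set E_{ikl} := ε_{il,k} − ε_{kl,i}. Then for every x₀ ∈ Ω and every skew-symmetric 3×3 matrix W there exists exactly one continuously differentiable skew-symmetric matrix field ω on Ω with ω(x₀) = W and ∂_l ω_{ik} = E_{ikl} on Ω for all i,k,l ∈ {1,2,3}. -/

import Mathlib

noncomputable section

open Matrix

/-- Points of 3-d Euclidean space, as triples of reals. -/
abbrev E3 : Type := Fin 3 → ℝ

/-- Partial derivative `∂_j f` of a scalar field `f` at `x`. -/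
noncomputable def pd (j : Fin 3) (f : E3 → ℝ) (x : E3) : ℝ :=
  fderiv ℝ f x (Pi.single j 1)

/-- The St.-Venant compatibility condition for a matrix field `ε` on `Ω`. -/
def StVenant (ε : Fin 3 → Fin 3 → E3 → ℝ) (Ω : Set E3) : Prop :=
  ∀ x ∈ Ω, ∀ i k l m : Fin 3,
    pd m (pd k (ε i l)) x - pd m (pd i (ε k l)) x
      - pd l (pd k (ε i m)) x + pd l (pd i (ε k m)) x = 0

/-- The field `E_{ikl} := ε_{il,k} − ε_{kl,i}` derived from a strain field `ε`. -/
noncomputable def Efield (ε : Fin 3 → Fin 3 → E3 → ℝ) (i k l : Fin 3) (x : E3) : ℝ :=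
  pd k (ε i l) x - pd i (ε k l) x

open Set Filter Topology in
/-- The real line with the discrete topology. -/
structure DiscR where
  val : ℝ

instance : TopologicalSpace DiscR := ⊥

instance : DiscreteTopology DiscR := ⟨rfl⟩

open Set Filter Topology in
/-- The bundle of germs of local primitives. -/
def primCore {B : Type} [TopologicalSpace B] (U : B → Set B) (φ : B → B → ℝ)
    (hU : ∀ i, IsOpen (U i)) (hmem : ∀ i, i ∈ U i)
    (hloc : ∀ i j, ∀ y ∈ U i ∩ U j, ∀ᶠ z in 𝓝 y, φ i z - φ j z = φ i y - φ j y) :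
    FiberBundleCore B B DiscR where
  baseSet := U
  isOpen_baseSet := hU
  indexAt := id
  mem_baseSet_at := hmem
  coordChange i j y c := ⟨c.val + (φ i y - φ j y)⟩
  coordChange_self i x _ v := by simp
  continuousOn_coordChange i j := by
    rintro ⟨y, c⟩ ⟨hy, -⟩
    apply ContinuousAt.continuousWithinAt
    have h : (fun p : B × DiscR => (⟨p.2.val + (φ i p.1 - φ j p.1)⟩ : DiscR))
        =ᶠ[𝓝 (y, c)] fun _ => ⟨c.val + (φ i y - φ j y)⟩ := by
      have h1 : ∀ᶠ p : B × DiscR in 𝓝 (y, c), φ i p.1 - φ j p.1 = φ i y - φ j y :=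
        (continuousAt_fst (p := (y, c))).eventually (hloc i j y hy)
      have h2 : ∀ᶠ p : B × DiscR in 𝓝 (y, c), p.2 = c :=
        (continuousAt_snd (p := (y, c))).eventually (p := fun w => w = c) (by simp [nhds_discrete])
      filter_upwards [h1, h2] with p hp1 hp2
      rw [hp1, hp2]
    exact h.continuousAt
  coordChange_comp i j k x _ v := by
    simp only [DiscR.mk.injEq]
    ring

open Set Filter Topology in
/-- Gluing of local functions with locally constant differences on a simply connected space. -/
theorem glue_prim {B : Type} [TopologicalSpace B] [SimplyConnectedSpace B]
    [LocallyPathConnectedSpace B] (U : B → Set B) (φ : B → B → ℝ)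
    (hU : ∀ i, IsOpen (U i)) (hmem : ∀ i, i ∈ U i)
    (hloc : ∀ i j, ∀ y ∈ U i ∩ U j, ∀ᶠ z in 𝓝 y, φ i z - φ j z = φ i y - φ j y) (b₀ : B) :
    ∃ g : B → ℝ, ∀ y, ∀ᶠ z in 𝓝 y, g z = φ y z + (g y - φ y y) := by
  let Z := primCore U φ hU hmem hloc
  have hcov : IsCoveringMap Z.proj :=
    IsFiberBundle.isCoveringMap (F := DiscR) fun x => ⟨Z.localTriv x, hmem x⟩
  obtain ⟨F, ⟨-, hF⟩, -⟩ := hcov.existsUnique_continuousMap_lifts (ContinuousMap.id B) b₀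
    (⟨b₀, (⟨0⟩ : DiscR)⟩ : Z.TotalSpace) rfl
  have hF' : ∀ y, (F y).1 = y := fun y => congrFun hF y
  refine ⟨fun y => (show DiscR from (F y).2).val + φ (F y).1 (F y).1, fun y => ?_⟩
  have hc : ContinuousAt (fun z => (Z.localTriv y (F z)).2) y := by
    refine continuousAt_snd.comp (ContinuousAt.comp (f := F) ?_ F.continuous.continuousAt)
    refine (Z.localTriv y).continuousAt ?_
    rw [Z.mem_localTriv_source]
    change (F y).1 ∈ U y
    rw [hF' y]
    exact hmem y
  have hev : ∀ᶠ z in 𝓝 y, (Z.localTriv y (F z)).2 = (Z.localTriv y (F y)).2 := by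
    have := hc.eventually (p := fun w => w = (Z.localTriv y (F y)).2)
    exact this (by simp [nhds_discrete])
  filter_upwards [hev] with z hz
  have hz' : (show DiscR from (F z).2).val + (φ (F z).1 (F z).1 - φ y (F z).1)
    = (show DiscR from (F y).2).val + (φ (F y).1 (F y).1 - φ y (F y).1) :=
    congrArg DiscR.val hz
  have e1 : φ y (F z).1 = φ y z := by rw [hF']
  have e2 : φ y (F y).1 = φ y y := by rw [hF']
  linarith

open Set Filter Topology in
/-- Closed one-forms on simply connected open sets are exact. -/
theorem exact_of_closed {Ω : Set E3} (hΩ : IsOpen Ω) (hsc : SimplyConnectedSpace Ω)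
    {η : E3 → E3 →L[ℝ] ℝ} (hη : DifferentiableOn ℝ η Ω)
    (hcl : ∀ a ∈ Ω, ∀ x y, fderiv ℝ η a x y = fderiv ℝ η a y x) (x₀ : Ω) :
    ∃ f : E3 → ℝ, ∀ x ∈ Ω, HasFDerivAt f (η x) x := by
  classical
  have hlp : LocallyPathConnectedSpace Ω := hΩ.locallyPathConnectedSpace
  have hloc : ∀ x : Ω, ∃ r > 0, Metric.ball (x : E3) r ⊆ Ω ∧
      ∃ f : E3 → ℝ, ∀ a ∈ Metric.ball (x : E3) r, HasFDerivAt f (η a) a := by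
    intro x
    obtain ⟨r, hr, hb⟩ := Metric.isOpen_iff.1 hΩ x x.2
    exact ⟨r, hr, hb, (convex_ball (x : E3) r).exists_forall_hasFDerivAt_of_fderiv_symmetric
      Metric.isOpen_ball (hη.mono hb) fun a ha => hcl a (hb ha)⟩
  choose r hr hb f hf using hloc
  obtain ⟨g, hg⟩ := glue_prim (B := Ω) (fun i => Subtype.val ⁻¹' Metric.ball (i : E3) (r i))
    (fun i z => f i z) (fun i => Metric.isOpen_ball.preimage continuous_subtype_val)
    (fun i => Metric.mem_ball_self (hr i)) (by
      rintro i j y ⟨hyi, hyj⟩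
      have ho : IsOpen (Metric.ball (i : E3) (r i) ∩ Metric.ball (j : E3) (r j)) :=
        Metric.isOpen_ball.inter Metric.isOpen_ball
      have hp : IsPreconnected (Metric.ball (i : E3) (r i) ∩ Metric.ball (j : E3) (r j)) :=
        ((convex_ball _ _).inter (convex_ball _ _)).isPreconnected
      have hd : ∀ z ∈ Metric.ball (i : E3) (r i) ∩ Metric.ball (j : E3) (r j),
          HasFDerivAt (fun z => f i z - f j z) (0 : E3 →L[ℝ] ℝ) z := fun z hz => by
        have h := (hf i z hz.1).sub (hf j z hz.2)
        rw [sub_self] at h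
        exact h
      have : ∀ᶠ z : Ω in 𝓝 y, (z : E3) ∈ Metric.ball (i : E3) (r i) ∩ Metric.ball (j : E3) (r j) :=
        continuous_subtype_val.continuousAt.eventually (ho.mem_nhds ⟨hyi, hyj⟩)
      filter_upwards [this] with z hz
      exact ho.is_const_of_fderiv_eq_zero (𝕜 := ℝ) (f := fun z => f i z - f j z) hp
        (fun z hz => (hd z hz).differentiableAt.differentiableWithinAt)
        (fun z hz => (hd z hz).fderiv) hz ⟨hyi, hyj⟩) x₀
  refine ⟨fun x => if hx : x ∈ Ω then g ⟨x, hx⟩ else 0, fun x hx => ?_⟩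
  have h1 := hg ⟨x, hx⟩
  have h2 : ∀ᶠ z in 𝓝 x, (if hz : z ∈ Ω then g ⟨z, hz⟩ else 0) =
      f ⟨x, hx⟩ z + (g ⟨x, hx⟩ - f ⟨x, hx⟩ x) := by
    rw [← map_nhds_subtype_coe_eq_nhds hx (hΩ.mem_nhds hx)]
    rw [eventually_map]
    filter_upwards [h1] with z hz
    rw [dif_pos z.2]
    exact hz
  exact ((hf ⟨x, hx⟩ x (Metric.mem_ball_self (hr _))).add_const _).congr_of_eventuallyEq h2

/-- The one-form with given components. -/
def oneForm (g : Fin 3 → E3 → ℝ) (x : E3) : E3 →L[ℝ] ℝ :=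
  ∑ l, g l x • ContinuousLinearMap.proj (R := ℝ) (φ := fun _ : Fin 3 => ℝ) l

theorem oneForm_single (g : Fin 3 → E3 → ℝ) (x : E3) (l : Fin 3) :
    oneForm g x (Pi.single l 1) = g l x := by
  simp [oneForm, Pi.single_apply]

theorem exists_potential {Ω : Set E3} (hΩ : IsOpen Ω) (hsc : SimplyConnectedSpace Ω)
    (g : Fin 3 → E3 → ℝ) (hg : ∀ l, ContDiffOn ℝ 1 (g l) Ω)
    (hcl : ∀ x ∈ Ω, ∀ l m, pd m (g l) x = pd l (g m) x) (x₀ : E3) (hx₀ : x₀ ∈ Ω) :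
    ∃ f : E3 → ℝ, ContDiffOn ℝ 1 f Ω ∧ ∀ x ∈ Ω, DifferentiableAt ℝ f x ∧
      ∀ l, pd l f x = g l x := by
  have hη : ContDiffOn ℝ 1 (oneForm g) Ω := by
    unfold oneForm
    exact ContDiffOn.sum fun l _ => (hg l).smul contDiffOn_const
  have hgd : ∀ x ∈ Ω, ∀ l, DifferentiableAt ℝ (g l) x := fun x hx l =>
    ((hg l).differentiableOn one_ne_zero).differentiableAt (hΩ.mem_nhds hx)
  have hder : ∀ x ∈ Ω, ∀ u v, fderiv ℝ (oneForm g) x u v = ∑ l, fderiv ℝ (g l) x u * v l := by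
    intro x hx u v
    have : HasFDerivAt (oneForm g) (∑ l, (fderiv ℝ (g l) x).smulRight
        (ContinuousLinearMap.proj (R := ℝ) (φ := fun _ : Fin 3 => ℝ) l)) x := by
      unfold oneForm
      exact HasFDerivAt.fun_sum fun l _ => HasFDerivAt.smul_const (F := E3 →L[ℝ] ℝ)
        (hgd x hx l).hasFDerivAt _
    rw [this.fderiv]
    simp
  have hexp : ∀ (x : E3) (l : Fin 3) (u : E3), fderiv ℝ (g l) x u = ∑ m, u m * pd m (g l) x := by
    intro x l u
    conv_lhs => rw [pi_eq_sum_univ' u]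
    simp [pd, map_sum]
  obtain ⟨f, hf⟩ := exact_of_closed hΩ hsc (hη.differentiableOn one_ne_zero) (by
    intro a ha u v
    rw [hder a ha, hder a ha]
    simp only [hexp, Finset.sum_mul]
    rw [Finset.sum_comm]
    refine Finset.sum_congr rfl fun m _ => Finset.sum_congr rfl fun l _ => ?_
    rw [hcl a ha l m]
    ring) ⟨x₀, hx₀⟩
  refine ⟨f, ?_, fun x hx => ⟨(hf x hx).differentiableAt, fun l => ?_⟩⟩
  · rw [← zero_add (1 : WithTop ℕ∞), contDiffOn_succ_iff_fderiv_of_isOpen hΩ]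
    refine ⟨fun x hx => (hf x hx).differentiableAt.differentiableWithinAt, by simp, ?_⟩
    rw [contDiffOn_zero]
    exact hη.continuousOn.congr fun x hx => (hf x hx).fderiv
  · rw [pd, (hf x hx).fderiv, oneForm_single]

theorem pd_sub {f g : E3 → ℝ} {x : E3} (hf : DifferentiableAt ℝ f x)
    (hg : DifferentiableAt ℝ g x) (l : Fin 3) :
    pd l (fun y => f y - g y) x = pd l f x - pd l g x := by
  unfold pd
  rw [fderiv_fun_sub hf hg]
  rfl

theorem eq_of_pd_eq {Ω : Set E3} (hΩ : IsOpen Ω) (hconn : IsConnected Ω) {f g : E3 → ℝ}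
    (hf : ContDiffOn ℝ 1 f Ω) (hg : ContDiffOn ℝ 1 g Ω)
    (h : ∀ x ∈ Ω, ∀ l, pd l f x = pd l g x) {x₀ : E3} (hx₀ : x₀ ∈ Ω) (h0 : f x₀ = g x₀)
    {x : E3} (hx : x ∈ Ω) : f x = g x := by
  refine hΩ.eqOn_of_fderiv_eq (𝕜 := ℝ) hconn.isPreconnected (hf.differentiableOn one_ne_zero)
    (hg.differentiableOn one_ne_zero) ?_ hx₀ h0 hx
  intro y hy
  ext v
  rw [pi_eq_sum_univ' v]
  simp only [map_sum, map_smul]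
  exact Finset.sum_congr rfl fun l _ => congrArg (v l • ·) (h y hy l)

theorem contDiffOn_pd {Ω : Set E3} (hΩ : IsOpen Ω) {f : E3 → ℝ} (hf : ContDiffOn ℝ 2 f Ω)
    (l : Fin 3) : ContDiffOn ℝ 1 (pd l f) Ω :=
  (hf.fderiv_of_isOpen hΩ (m := 1) (by norm_num)).clm_apply contDiffOn_const

/-- On a connected, simply connected open set `Ω ⊆ ℝ³`, given a C² symmetric matrix field
`ε` satisfying St.-Venant compatibility, a point `x₀ ∈ Ω` and a skew matrix `W`, there is
exactly one C¹ skew-symmetric matrix field `ω` on `Ω` with `ω(x₀) = W` and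
`∂_l ω_{ik} = E_{ikl}` on `Ω`. -/
theorem weingarten_stmt4 (Ω : Set E3) (hΩ : IsOpen Ω) (hconn : IsConnected Ω)
    (hsc : SimplyConnectedSpace Ω)
    (ε : Fin 3 → Fin 3 → E3 → ℝ)
    (hreg : ∀ i j, ContDiffOn ℝ 2 (ε i j) Ω)
    (hsym : ∀ i j, ∀ x ∈ Ω, ε i j x = ε j i x)
    (hSV : StVenant ε Ω)
    (x₀ : E3) (hx₀ : x₀ ∈ Ω)
    (W : Matrix (Fin 3) (Fin 3) ℝ) (hW : Wᵀ = -W) :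
    ∃ ω : E3 → Matrix (Fin 3) (Fin 3) ℝ,
      ((∀ i k, ContDiffOn ℝ 1 (fun x => ω x i k) Ω) ∧
        (∀ x ∈ Ω, (ω x)ᵀ = -(ω x)) ∧
        ω x₀ = W ∧
        (∀ x ∈ Ω, ∀ i k l : Fin 3, pd l (fun y => ω y i k) x = Efield ε i k l x)) ∧
      (∀ ω' : E3 → Matrix (Fin 3) (Fin 3) ℝ,
        ((∀ i k, ContDiffOn ℝ 1 (fun x => ω' x i k) Ω) ∧
          (∀ x ∈ Ω, (ω' x)ᵀ = -(ω' x)) ∧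
          ω' x₀ = W ∧
          (∀ x ∈ Ω, ∀ i k l : Fin 3, pd l (fun y => ω' y i k) x = Efield ε i k l x)) →
        ∀ x ∈ Ω, ω' x = ω x) := by
  have hpd : ∀ i j l, ContDiffOn ℝ 1 (pd l (ε i j)) Ω := fun i j l => contDiffOn_pd hΩ (hreg i j) l
  have hpdd : ∀ i j l, ∀ x ∈ Ω, DifferentiableAt ℝ (pd l (ε i j)) x := fun i j l x hx =>
    ((hpd i j l).differentiableOn one_ne_zero).differentiableAt (hΩ.mem_nhds hx)
  have hpot : ∀ i k, ∃ f : E3 → ℝ, ContDiffOn ℝ 1 f Ω ∧ ∀ x ∈ Ω, DifferentiableAt ℝ f x ∧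
      ∀ l, pd l f x = Efield ε i k l x := by
    intro i k
    refine exists_potential hΩ hsc (fun l => Efield ε i k l)
      (fun l => (hpd i l k).sub (hpd k l i)) ?_ x₀ hx₀
    intro x hx l m
    have h1 : ∀ l m, pd m (Efield ε i k l) x = pd m (pd k (ε i l)) x - pd m (pd i (ε k l)) x :=
      fun l m => pd_sub (hpdd i l k x hx) (hpdd k l i x hx) m
    rw [h1, h1]
    linarith [hSV x hx i k l m]
  choose f hfc hf using hpot
  suffices hex : ∃ ω : E3 → Matrix (Fin 3) (Fin 3) ℝ,
      ((∀ i k, ContDiffOn ℝ 1 (fun x => ω x i k) Ω) ∧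
        (∀ x ∈ Ω, (ω x)ᵀ = -(ω x)) ∧
        ω x₀ = W ∧
        (∀ x ∈ Ω, ∀ i k l : Fin 3, pd l (fun y => ω y i k) x = Efield ε i k l x)) by
    obtain ⟨ω, h⟩ := hex
    refine ⟨ω, h, ?_⟩
    rintro ω' ⟨hc, -, h0, hE⟩ x hx
    ext i k
    refine eq_of_pd_eq hΩ hconn (hc i k) (h.1 i k) ?_ hx₀ (by rw [h0, h.2.2.1]) hx
    intro y hy l
    rw [hE y hy, h.2.2.2 y hy]
  refine ⟨fun x => Matrix.of fun i k => ((f i k x - f k i x) - (f i k x₀ - f k i x₀)) / 2 + W i k,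
    fun i k => ?_, fun x _ => ?_, ?_, fun x hx i k l => ?_⟩
  · simp only [Matrix.of_apply]
    exact ((((hfc i k).sub (hfc k i)).sub contDiffOn_const).div_const 2).add contDiffOn_const
  · ext i k
    have := congrFun (congrFun hW i) k
    simp only [Matrix.transpose_apply, Matrix.neg_apply, Matrix.of_apply] at this ⊢
    rw [this]
    ring
  · ext i k
    simp
  · have hd : HasFDerivAt (fun y => ((f i k y - f k i y) - (f i k x₀ - f k i x₀)) / 2 + W i k)
        ((2 : ℝ)⁻¹ • (fderiv ℝ (f i k) x - fderiv ℝ (f k i) x)) x := by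
      simp only [div_eq_mul_inv]
      exact ((((hf i k x hx).1.hasFDerivAt.sub (hf k i x hx).1.hasFDerivAt).sub_const _).mul_const
        (2 : ℝ)⁻¹).add_const _
    have h1 := (hf i k x hx).2 l
    have h2 := (hf k i x hx).2 l
    simp only [Matrix.of_apply]
    rw [pd, hd.fderiv]
    simp only [pd, Efield] at h1 h2 ⊢
    simp only [_root_.smul_apply, _root_.sub_apply, smul_eq_mul, h1, h2]
    ring
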